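/- Let a ∈ 𝔻 \ {0}, set b := −a, and let γ ∈ ℂ satisfy |a|² < |γ| ≤ |a|^{3/2}. Then limsup_{ε→0, ε≠0} L^ε_{aVbV}(0, γ) < min{ L_{a0b0}(0,γ), L_{aVb0}(0,γ), L_{a0bV}(0,γ), L_{aVbV}(0,γ) }, where the limsup is over complex ε ≠ 0 tending to 0; that is, the corrected generalized Lempert function 𝐿̃_{aVbV} = min{L_{a0b0}, L_{aVb0}, L_{a0bV}, L_{aVbV}} is NOT the limit of the four-pole Lempert functions L^ε_{aVbV} as the poles collide. -/

import Mathlib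

open Complex Metric Filter Topology

noncomputable section

/-- The open unit disc in `ℂ`. -/
def unitDisc : Set ℂ := Metric.ball 0 1

/-- Extended-real logarithm, with the convention `log 0 = ⊥`. -/
def elog (x : ℝ) : EReal := if x = 0 then ⊥ else ((Real.log x : ℝ) : EReal)

/-- The Möbius involution of the unit disc exchanging `ξ` and `0`. -/
def mobius (ξ ζ : ℂ) : ℂ := (ξ - ζ) / (1 - (starRingEnd ℂ) ξ * ζ)

/-- An analytic disc in the bidisc `𝔻²`, given by its two components. -/
def AnalyticDisc2 (φ₁ φ₂ : ℂ → ℂ) : Prop :=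
  DifferentiableOn ℂ φ₁ unitDisc ∧ DifferentiableOn ℂ φ₂ unitDisc ∧
  (∀ w ∈ unitDisc, φ₁ w ∈ unitDisc) ∧ (∀ w ∈ unitDisc, φ₂ w ∈ unitDisc)

/-- The Lempert function with the two simple poles `(a,0)`, `(b,0)` in the bidisc. -/
def La0b0 (a b : ℂ) (z : ℂ × ℂ) : EReal :=
  sInf { t : EReal | ∃ (φ₁ φ₂ : ℂ → ℂ) (ζ₁ ζ₂ : ℂ),
    AnalyticDisc2 φ₁ φ₂ ∧ ζ₁ ∈ unitDisc ∧ ζ₂ ∈ unitDisc ∧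
    φ₁ 0 = z.1 ∧ φ₂ 0 = z.2 ∧
    φ₁ ζ₁ = a ∧ φ₂ ζ₁ = 0 ∧ φ₁ ζ₂ = b ∧ φ₂ ζ₂ = 0 ∧
    t = elog (‖ζ₁‖) + elog (‖ζ₂‖) }

/-- The generalized Lempert function with vertical indicator at `(a,0)` and
simple pole `(b,0)`. -/
def LaVb0 (a b : ℂ) (z : ℂ × ℂ) : EReal :=
  sInf { t : EReal | ∃ (φ₁ φ₂ : ℂ → ℂ) (ζ₁ ζ₂ : ℂ),
    AnalyticDisc2 φ₁ φ₂ ∧ ζ₁ ∈ unitDisc ∧ ζ₂ ∈ unitDisc ∧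
    φ₁ 0 = z.1 ∧ φ₂ 0 = z.2 ∧
    φ₁ ζ₁ = a ∧ φ₂ ζ₁ = 0 ∧ φ₁ ζ₂ = b ∧ φ₂ ζ₂ = 0 ∧
    deriv φ₁ ζ₁ = 0 ∧
    t = elog (‖ζ₁‖) + elog (‖ζ₁‖) + elog (‖ζ₂‖) }

/-- The generalized Lempert function with simple pole `(a,0)` and vertical
indicator at `(b,0)`. -/
def La0bV (a b : ℂ) (z : ℂ × ℂ) : EReal :=
  sInf { t : EReal | ∃ (φ₁ φ₂ : ℂ → ℂ) (ζ₁ ζ₂ : ℂ),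
    AnalyticDisc2 φ₁ φ₂ ∧ ζ₁ ∈ unitDisc ∧ ζ₂ ∈ unitDisc ∧
    φ₁ 0 = z.1 ∧ φ₂ 0 = z.2 ∧
    φ₁ ζ₁ = a ∧ φ₂ ζ₁ = 0 ∧ φ₁ ζ₂ = b ∧ φ₂ ζ₂ = 0 ∧
    deriv φ₁ ζ₂ = 0 ∧
    t = elog (‖ζ₁‖) + elog (‖ζ₂‖) + elog (‖ζ₂‖) }

/-- The generalized Lempert function with vertical indicators at `(a,0)` and `(b,0)`. -/
def LaVbV (a b : ℂ) (z : ℂ × ℂ) : EReal :=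
  sInf { t : EReal | ∃ (φ₁ φ₂ : ℂ → ℂ) (ζ₁ ζ₂ : ℂ),
    AnalyticDisc2 φ₁ φ₂ ∧ ζ₁ ∈ unitDisc ∧ ζ₂ ∈ unitDisc ∧
    φ₁ 0 = z.1 ∧ φ₂ 0 = z.2 ∧
    φ₁ ζ₁ = a ∧ φ₂ ζ₁ = 0 ∧ φ₁ ζ₂ = b ∧ φ₂ ζ₂ = 0 ∧
    deriv φ₁ ζ₁ = 0 ∧ deriv φ₁ ζ₂ = 0 ∧
    t = elog (‖ζ₁‖) + elog (‖ζ₁‖)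
        + elog (‖ζ₂‖) + elog (‖ζ₂‖) }

/-- Coman's Lempert function with the three simple poles `(a,0)`, `(b,0)`, `(b,ε)`. -/
def Leps3 (a b ε : ℂ) (z : ℂ × ℂ) : EReal :=
  sInf { t : EReal | ∃ (φ₁ φ₂ : ℂ → ℂ) (ζ₁ ζ₂ ζ₃ : ℂ),
    AnalyticDisc2 φ₁ φ₂ ∧ ζ₁ ∈ unitDisc ∧ ζ₂ ∈ unitDisc ∧ ζ₃ ∈ unitDisc ∧
    φ₁ 0 = z.1 ∧ φ₂ 0 = z.2 ∧
    φ₁ ζ₁ = a ∧ φ₂ ζ₁ = 0 ∧ φ₁ ζ₂ = b ∧ φ₂ ζ₂ = 0 ∧ φ₁ ζ₃ = b ∧ φ₂ ζ₃ = ε ∧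
    t = elog (‖ζ₁‖) + elog (‖ζ₂‖) + elog (‖ζ₃‖) }

/-- Coman's Lempert function with the four simple poles
`(a,0)`, `(b,0)`, `(b,ε)`, `(a,ε)`. -/
def Leps4 (a b ε : ℂ) (z : ℂ × ℂ) : EReal :=
  sInf { t : EReal | ∃ (φ₁ φ₂ : ℂ → ℂ) (ζ₁ ζ₂ ζ₃ ζ₄ : ℂ),
    AnalyticDisc2 φ₁ φ₂ ∧ ζ₁ ∈ unitDisc ∧ ζ₂ ∈ unitDisc ∧ ζ₃ ∈ unitDisc ∧ ζ₄ ∈ unitDisc ∧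
    φ₁ 0 = z.1 ∧ φ₂ 0 = z.2 ∧
    φ₁ ζ₁ = a ∧ φ₂ ζ₁ = 0 ∧ φ₁ ζ₂ = b ∧ φ₂ ζ₂ = 0 ∧
    φ₁ ζ₃ = b ∧ φ₂ ζ₃ = ε ∧ φ₁ ζ₄ = a ∧ φ₂ ζ₄ = ε ∧
    t = elog (‖ζ₁‖) + elog (‖ζ₂‖)
        + elog (‖ζ₃‖) + elog (‖ζ₄‖) }


theorem mem_uD {z : ℂ} : z ∈ unitDisc ↔ ‖z‖ < 1 := by simp [unitDisc]

theorem uD_open : IsOpen unitDisc := Metric.isOpen_ball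

theorem uD_nhds {z : ℂ} (hz : z ∈ unitDisc) : unitDisc ∈ 𝓝 z := uD_open.mem_nhds hz

theorem mob_den {ξ z : ℂ} (hξ : ‖ξ‖ < 1) (hz : ‖z‖ ≤ 1) : 1 - (starRingEnd ℂ) ξ * z ≠ 0 := by
  intro h
  have h1 : (starRingEnd ℂ) ξ * z = 1 := by linear_combination -h
  have h2 : ‖(starRingEnd ℂ) ξ * z‖ = 1 := by rw [h1]; simp
  rw [norm_mul, RCLike.norm_conj] at h2
  nlinarith [norm_nonneg ξ, norm_nonneg z]

theorem normSq_id (ξ z : ℂ) :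
    ‖1 - (starRingEnd ℂ) ξ * z‖ ^ 2 - ‖ξ - z‖ ^ 2 = (1 - ‖ξ‖ ^ 2) * (1 - ‖z‖ ^ 2) := by
  simp only [← Complex.normSq_eq_norm_sq, Complex.normSq_apply]
  simp
  ring

theorem mob_lt {ξ z : ℂ} (hξ : ‖ξ‖ < 1) (hz : ‖z‖ < 1) : ‖mobius ξ z‖ < 1 := by
  have hd := norm_pos_iff.2 (mob_den hξ hz.le)
  rw [mobius, norm_div, div_lt_one hd]
  have := normSq_id ξ z
  have h3 : 0 < (1 - ‖ξ‖ ^ 2) * (1 - ‖z‖ ^ 2) := by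
    apply mul_pos <;> nlinarith [norm_nonneg ξ, norm_nonneg z]
  nlinarith [norm_nonneg (ξ - z)]

theorem mob_invol {ξ z : ℂ} (hξ : ‖ξ‖ < 1) (hz : ‖z‖ < 1) : mobius ξ (mobius ξ z) = z := by
  have hd := mob_den hξ hz.le
  have hd' := mob_den hξ (mob_lt hξ hz).le
  have hd2 := mob_den hξ hξ.le
  rw [mobius, div_eq_iff hd']
  unfold mobius
  generalize (starRingEnd ℂ) ξ = k at hd
  have e : (ξ - z) / (1 - k * z) * (1 - k * z) = ξ - z := div_mul_cancel₀ _ hd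
  apply mul_right_cancel₀ hd
  linear_combination (-1 + z * k) * e

theorem mob_self (ξ : ℂ) : mobius ξ ξ = 0 := by simp [mobius]
theorem mob_zero (ξ : ℂ) : mobius ξ 0 = ξ := by simp [mobius]

theorem mob_eq_zero {ξ z : ℂ} (hξ : ‖ξ‖ < 1) (hz : ‖z‖ < 1) (h : mobius ξ z = 0) : z = ξ := by
  have := mob_invol hξ hz
  rw [h, mob_zero] at this
  exact this.symm

theorem mob_hasDeriv {ξ z : ℂ} (hξ : ‖ξ‖ < 1) (hz : ‖z‖ ≤ 1) :
    HasDerivAt (mobius ξ) (((‖ξ‖ ^ 2 - 1 : ℝ) : ℂ) / (1 - (starRingEnd ℂ) ξ * z) ^ 2) z := by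
  have hd := mob_den hξ hz
  have h1 : HasDerivAt (fun w : ℂ => ξ - w) (-1) z := by
    simpa using (hasDerivAt_id z).const_sub ξ
  have h2 : HasDerivAt (fun w : ℂ => 1 - (starRingEnd ℂ) ξ * w) (-(starRingEnd ℂ) ξ) z := by
    simpa using ((hasDerivAt_id z).const_mul ((starRingEnd ℂ) ξ)).const_sub 1
  have h3 := h1.div h2 hd
  have h4 : ((‖ξ‖ ^ 2 : ℝ) : ℂ) = (starRingEnd ℂ) ξ * ξ := by
    rw [mul_comm, Complex.mul_conj, Complex.normSq_eq_norm_sq]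
  have h5 : ((‖ξ‖ ^ 2 - 1 : ℝ) : ℂ)
      = -1 * (1 - (starRingEnd ℂ) ξ * z) - (ξ - z) * -(starRingEnd ℂ) ξ := by
    push_cast at h4 ⊢
    rw [h4]; ring
  rw [h5]
  exact h3

theorem mob_diffOn {ξ : ℂ} (hξ : ‖ξ‖ < 1) : DifferentiableOn ℂ (mobius ξ) unitDisc := fun z hz =>
  (mob_hasDeriv hξ (mem_uD.1 hz).le).differentiableAt.differentiableWithinAt

/-- Schur class functions on the disc. -/
def Schur (f : ℂ → ℂ) : Prop := DifferentiableOn ℂ f unitDisc ∧ ∀ z ∈ unitDisc, ‖f z‖ ≤ 1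

theorem Schur.hasDeriv {f : ℂ → ℂ} (hf : Schur f) {z : ℂ} (hz : ‖z‖ < 1) :
    HasDerivAt f (deriv f z) z :=
  (hf.1.differentiableAt (uD_nhds (mem_uD.2 hz))).hasDerivAt

theorem Schur.le_mob {f : ℂ → ℂ} (hf : Schur f) {ξ : ℂ} (hξ : ‖ξ‖ < 1) (h0 : f ξ = 0)
    {z : ℂ} (hz : ‖z‖ < 1) : ‖f z‖ ≤ ‖mobius ξ z‖ := by
  have h1 : DifferentiableOn ℂ (f ∘ mobius ξ) (ball 0 1) :=
    hf.1.comp (mob_diffOn hξ) (fun w hw => mem_uD.2 (mob_lt hξ (mem_uD.1 hw)))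
  have h2 := Complex.norm_le_norm_of_mapsTo_ball (z := mobius ξ z) h1
    (fun w hw => by
      simpa using hf.2 _ (mem_uD.2 (mob_lt hξ (mem_uD.1 hw))))
    (by simp [mob_zero, h0]) (mob_lt hξ hz)
  simpa [mob_invol hξ hz] using h2

theorem Schur.divide {f : ℂ → ℂ} (hf : Schur f) {ξ : ℂ} (hξ : ‖ξ‖ < 1) (h0 : f ξ = 0) :
    ∃ g, Schur g ∧ (∀ z ∈ unitDisc, f z = mobius ξ z * g z) := by
  have hmem : ξ ∈ unitDisc := mem_uD.2 hξ
  have hdg : DifferentiableOn ℂ (fun z => -((1 - (starRingEnd ℂ) ξ * z) * dslope f ξ z)) unitDisc := by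
    have := (Complex.differentiableOn_dslope (uD_nhds hmem)).2 hf.1
    apply DifferentiableOn.neg
    apply DifferentiableOn.mul _ this
    fun_prop
  have heq : ∀ z ∈ unitDisc, f z = mobius ξ z * (-((1 - (starRingEnd ℂ) ξ * z) * dslope f ξ z)) := by
    intro z hz
    have hd := mob_den hξ (mem_uD.1 hz).le
    have := sub_smul_dslope f ξ z
    rw [h0, smul_eq_mul] at this
    rw [mobius, ← mul_neg, ← mul_assoc, div_mul_cancel₀ _ hd]
    linear_combination -this
  refine ⟨_, ⟨hdg, ?_⟩, heq⟩
  have hne : ∀ z ∈ unitDisc, z ≠ ξ → ‖-((1 - (starRingEnd ℂ) ξ * z) * dslope f ξ z)‖ ≤ 1 := by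
    intro z hz hzξ
    have h1 := hf.le_mob hξ h0 (mem_uD.1 hz)
    rw [heq z hz, norm_mul] at h1
    have h2 : 0 < ‖mobius ξ z‖ := norm_pos_iff.2 fun h => hzξ (mob_eq_zero hξ (mem_uD.1 hz) h)
    nlinarith
  intro z hz
  by_cases h : z = ξ
  · subst h
    have hc := (hdg.continuousOn.continuousAt (uD_nhds hz)).norm
    have hc' := hc.tendsto.mono_left (nhdsWithin_le_nhds (s := {z}ᶜ))
    refine le_of_tendsto hc' ?_
    filter_upwards [self_mem_nhdsWithin, nhdsWithin_le_nhds (uD_nhds hz)] with w hw hw'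
    exact hne w hw' hw
  · exact hne z hz h

/-- If moreover the derivative vanishes, the quotient vanishes. -/
theorem divide_deriv {f g : ℂ → ℂ} (hg : Schur g) {ξ : ℂ} (hξ : ‖ξ‖ < 1)
    (h : ∀ z ∈ unitDisc, f z = mobius ξ z * g z) (hd : deriv f ξ = 0) : g ξ = 0 := by
  have h1 := (mob_hasDeriv hξ hξ.le).mul (hg.hasDeriv hξ)
  have h2 : f =ᶠ[𝓝 ξ] (mobius ξ * g) := by
    filter_upwards [uD_nhds (mem_uD.2 hξ)] with z hz using h z hz
  have h3 := (h1.congr_of_eventuallyEq h2).deriv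
  rw [hd, mob_self] at h3
  have h4 := mob_den hξ hξ.le
  have h5 : ((‖ξ‖ ^ 2 - 1 : ℝ) : ℂ) ≠ 0 := by
    have : ‖ξ‖ ^ 2 - 1 ≠ 0 := by nlinarith [norm_nonneg ξ]
    exact_mod_cast this
  have h6 : ((‖ξ‖ ^ 2 - 1 : ℝ) : ℂ) / (1 - (starRingEnd ℂ) ξ * ξ) ^ 2 * g ξ = 0 := by
    rw [zero_mul, add_zero] at h3; exact h3.symm
  rcases mul_eq_zero.1 h6 with h7 | h7
  · exact absurd h7 (div_ne_zero h5 (pow_ne_zero _ h4))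
  · exact h7

theorem Schur.dichotomy {f : ℂ → ℂ} (hf : Schur f) {c : ℂ} (hc : ‖c‖ < 1) (h : ‖f c‖ = 1) :
    ∀ z ∈ unitDisc, f z = f c := by
  intro z hz
  exact Complex.eqOn_of_isPreconnected_of_isMaxOn_norm (convex_ball (0:ℂ) 1).isPreconnected
    uD_open hf.1 (mem_uD.2 hc) (fun w hw => by simpa [h] using hf.2 w hw) hz

theorem Schur.lt_one {f : ℂ → ℂ} (hf : Schur f) {c : ℂ} (hc : ‖c‖ < 1) (h : ‖f c‖ < 1) :
    ∀ z ∈ unitDisc, ‖f z‖ < 1 := by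
  intro z hz
  refine lt_of_le_of_ne (hf.2 z hz) fun h1 => ?_
  have := hf.dichotomy (mem_uD.1 hz) h1 c (mem_uD.2 hc)
  rw [this, h1] at h
  exact lt_irrefl _ h

theorem Schur.mob_comp {f : ℂ → ℂ} (hf : DifferentiableOn ℂ f unitDisc)
    (hf' : ∀ z ∈ unitDisc, ‖f z‖ < 1) {ξ : ℂ} (hξ : ‖ξ‖ < 1) :
    Schur (fun z => mobius ξ (f z)) :=
  ⟨(mob_diffOn hξ).comp hf (fun w hw => mem_uD.2 (hf' w hw)),
   fun z hz => (mob_lt hξ (hf' z hz)).le⟩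

/-- Elementary: pseudohyperbolic distance of moduli. -/
theorem mob_norm_ge {u v : ℂ} (hu : ‖u‖ < 1) (hv : ‖v‖ < 1) {R : ℝ} (hR1 : R < 1)
    (h : ‖mobius u v‖ ≤ R) : (1 - R) * (1 - ‖v‖) ≤ (1 + R) * (1 - ‖u‖) := by
  have hd := norm_pos_iff.2 (mob_den hu hv.le)
  rw [mobius, norm_div, div_le_iff₀ hd] at h
  have hR0 : 0 ≤ R := by
    by_contra hc
    nlinarith [norm_nonneg (u - v)]
  by_cases huv : ‖u‖ ≤ ‖v‖
  · nlinarith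
  push Not at huv
  have key := normSq_id u v
  set D := ‖1 - (starRingEnd ℂ) u * v‖
  set N := ‖u - v‖
  have h1 : N ^ 2 ≤ R ^ 2 * D ^ 2 := by
    have := norm_nonneg (u - v)
    nlinarith
  have hN : (‖u‖ - ‖v‖) ^ 2 ≤ N ^ 2 := by
    have := norm_sub_norm_le u v
    nlinarith
  -- D² (1-R²) ≤ (1-u²)(1-v²)
  have h2 : N ^ 2 * (1 - R ^ 2) ≤ R ^ 2 * ((1 - ‖u‖ ^ 2) * (1 - ‖v‖ ^ 2)) := by nlinarith
  have h3 : (‖u‖ - ‖v‖) ^ 2 * (1 - R ^ 2) ≤ R ^ 2 * ((1 - ‖u‖ ^ 2) * (1 - ‖v‖ ^ 2)) := by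
    have : 0 ≤ 1 - R ^ 2 := by nlinarith
    nlinarith
  have h4 : (‖u‖ - ‖v‖) ^ 2 ≤ (R * (1 - ‖u‖ * ‖v‖)) ^ 2 := by nlinarith
  have h5 : 0 ≤ R * (1 - ‖u‖ * ‖v‖) := by
    apply mul_nonneg hR0
    nlinarith [norm_nonneg u, norm_nonneg v]
  have h6 : ‖u‖ - ‖v‖ ≤ R * (1 - ‖u‖ * ‖v‖) := by
    exact abs_le_of_sq_le_sq' h4 h5 |>.2
  have h7 : 0 ≤ R * ((1 - ‖u‖) * (1 - ‖v‖)) := by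
    apply mul_nonneg hR0 (mul_nonneg _ _) <;> linarith
  nlinarith

/-- Harnack type comparison. -/
theorem Schur.harnack {f : ℂ → ℂ} (hf : Schur f) {c w : ℂ} (hc : ‖c‖ < 1) (hw : ‖w‖ < 1)
    {R : ℝ} (hR1 : R < 1) (h : ‖mobius c w‖ ≤ R) :
    (1 - R) * (1 - ‖f w‖) ≤ (1 + R) * (1 - ‖f c‖) := by
  have hR0 : 0 ≤ R := (norm_nonneg _).trans h
  rcases (hf.2 c (mem_uD.2 hc)).lt_or_eq with h1 | h1
  · have h2 := hf.lt_one hc h1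
    have h3 := Schur.mob_comp hf.1 h2 h1
    have h4 := h3.le_mob hc (by simp [mob_self]) hw
    exact mob_norm_ge h1 (h2 w (mem_uD.2 hw)) hR1 (h4.trans h)
  · have := hf.dichotomy hc h1 w (mem_uD.2 hw)
    rw [this, h1]; simp

theorem Schur.harnack0 {f : ℂ → ℂ} (hf : Schur f) {w : ℂ}
    {R : ℝ} (hR1 : R < 1) (hw : ‖w‖ ≤ R) :
    (1 - R) * (1 - ‖f w‖) ≤ (1 + R) * (1 - ‖f 0‖) :=
  hf.harnack (by simp) (hw.trans_lt hR1) hR1 (by simpa [mobius] using hw)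

theorem Schur.harnack0' {f : ℂ → ℂ} (hf : Schur f) {w : ℂ}
    {R : ℝ} (hR1 : R < 1) (hw : ‖w‖ ≤ R) :
    (1 - R) * (1 - ‖f 0‖) ≤ (1 + R) * (1 - ‖f w‖) :=
  hf.harnack (hw.trans_lt hR1) (by simp) hR1 (by simpa [mobius] using hw)

/-- Schwarz-Pick for derivatives. -/
theorem Schur.pick {f : ℂ → ℂ} (hf : Schur f) {w : ℂ} (hw : ‖w‖ < 1) :
    ‖deriv f w‖ * (1 - ‖w‖ ^ 2) ≤ 1 - ‖f w‖ ^ 2 := by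
  rcases (hf.2 w (mem_uD.2 hw)).lt_or_eq with h1 | h1
  · have h2 := hf.lt_one hw h1
    have h3 := Schur.mob_comp hf.1 h2 h1
    obtain ⟨g, hg, hfg⟩ := h3.divide hw (by simp [mob_self])
    have e1 := (mob_hasDeriv h1 h1.le).comp w (hf.hasDeriv hw)
    have e2 := (mob_hasDeriv hw hw.le).mul (hg.hasDeriv hw)
    have e3 : (mobius (f w) ∘ f) =ᶠ[𝓝 w] (mobius w * g) := by
      filter_upwards [uD_nhds (mem_uD.2 hw)] with z hz using hfg z hz
    have e4 := (e2.congr_of_eventuallyEq e3).unique e1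
    have cc : ∀ x : ℂ, (starRingEnd ℂ) x * x = ((‖x‖ ^ 2 : ℝ) : ℂ) := fun x => by
      rw [mul_comm, Complex.mul_conj, Complex.normSq_eq_norm_sq]
    have cn : ∀ x : ℂ, ‖x‖ < 1 → ‖((‖x‖ ^ 2 - 1 : ℝ) : ℂ) / (1 - (starRingEnd ℂ) x * x) ^ 2‖
        = (1 - ‖x‖ ^ 2)⁻¹ := fun x hx => by
      have h0 : 0 < 1 - ‖x‖ ^ 2 := by nlinarith [norm_nonneg x]
      rw [cc, norm_div, norm_pow]
      rw [show (1 : ℂ) - ((‖x‖ ^ 2 : ℝ) : ℂ) = ((1 - ‖x‖ ^ 2 : ℝ) : ℂ) by push_cast; ring]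
      rw [Complex.norm_real, Complex.norm_real, Real.norm_of_nonneg h0.le, norm_sub_rev,
        Real.norm_of_nonneg h0.le]
      field_simp
    rw [mob_self, zero_mul, add_zero] at e4
    have e5 := congrArg norm e4
    rw [norm_mul, norm_mul, cn _ hw, cn _ h1] at e5
    have h0 : 0 < 1 - ‖w‖ ^ 2 := by nlinarith [norm_nonneg w]
    have h0' : 0 < 1 - ‖f w‖ ^ 2 := by nlinarith [norm_nonneg (f w)]
    field_simp at e5
    have := hg.2 w (mem_uD.2 hw)
    nlinarith
  · have h2 := hf.dichotomy hw h1
    have : f =ᶠ[𝓝 w] fun _ => f w := by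
      filter_upwards [uD_nhds (mem_uD.2 hw)] with z hz using h2 z hz
    rw [this.deriv_eq, h1]
    simp

theorem double_zero {φ : ℂ → ℂ} {a ζ : ℂ} (hφ : DifferentiableOn ℂ φ unitDisc)
    (hφ' : ∀ w ∈ unitDisc, φ w ∈ unitDisc) (ha : ‖a‖ < 1) (hζ : ‖ζ‖ < 1)
    (h1 : φ ζ = a) (h2 : deriv φ ζ = 0) :
    ∃ h, Schur h ∧ ∀ z ∈ unitDisc, mobius a (φ z) = mobius ζ z ^ 2 * h z := by
  have hS := Schur.mob_comp hφ (fun z hz => mem_uD.1 (hφ' z hz)) ha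
  obtain ⟨g, hg, hfg⟩ := hS.divide hζ (by simp [h1, mob_self])
  have hd : deriv (fun z => mobius a (φ z)) ζ = 0 := by
    have e1 : HasDerivAt φ 0 ζ := by
      rw [← h2]
      exact (hφ.differentiableAt (uD_nhds (mem_uD.2 hζ))).hasDerivAt
    have e2 := mob_hasDeriv ha ha.le
    rw [← h1] at e2
    have e3 := (e2.comp ζ e1).deriv
    rw [mul_zero, h1] at e3
    exact e3
  have g0 := divide_deriv hg hζ hfg hd
  obtain ⟨k, hk, hgk⟩ := hg.divide hζ g0
  refine ⟨k, hk, fun z hz => ?_⟩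
  rw [hfg z hz, hgk z hz]; ring

theorem zero_uD : (0 : ℂ) ∈ unitDisc := mem_uD.2 (by simp)

theorem double_zero_norm {φ h : ℂ → ℂ} {a ζ : ℂ} (hh : Schur h) (h0 : φ 0 = 0)
    (e : ∀ z ∈ unitDisc, mobius a (φ z) = mobius ζ z ^ 2 * h z) :
    ‖a‖ = ‖ζ‖ ^ 2 * ‖h 0‖ ∧ ‖a‖ ≤ ‖ζ‖ ^ 2 := by
  have := congrArg norm (e 0 zero_uD)
  rw [h0, mob_zero, mob_zero, norm_mul, norm_pow] at this
  refine ⟨this, ?_⟩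
  have := hh.2 0 zero_uD
  nlinarith [sq_nonneg ‖ζ‖]

set_option maxHeartbeats 2000000 in
theorem lower_V0 {a : ℂ} (ha : ‖a‖ < 1) (ha0 : a ≠ 0) :
    ∃ M : ℝ, ‖a‖ ^ 2 < M ∧ ∀ (φ : ℂ → ℂ) (ζ₁ ζ₂ : ℂ), DifferentiableOn ℂ φ unitDisc →
      (∀ w ∈ unitDisc, φ w ∈ unitDisc) → ζ₁ ∈ unitDisc → ζ₂ ∈ unitDisc → φ 0 = 0 →
      φ ζ₁ = a → φ ζ₂ = -a → deriv φ ζ₁ = 0 → M ≤ ‖ζ₁‖ * ‖ζ₁‖ * ‖ζ₂‖ := by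
  have hr : 0 < ‖a‖ := norm_pos_iff.2 ha0
  set r := ‖a‖ with hrdef
  set q := (1 + r) / 2 with hq
  set R := √q with hR
  have hq1 : q < 1 := by rw [hq]; linarith
  have hq0 : 0 < q := by rw [hq]; linarith
  have hR0 : 0 < R := Real.sqrt_pos.2 hq0
  have hR2 : R ^ 2 = q := Real.sq_sqrt hq0.le
  have hR1 : R < 1 := by nlinarith
  set d := (1 - R) ^ 2 * (1 - r) / 8 with hd
  have hd0 : 0 < d := by
    have : 0 < (1 - R) ^ 2 := by have : 0 < 1 - R := by linarith
                                 positivity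
    have : 0 < 1 - r := by linarith
    positivity
  refine ⟨min (r * q) (r ^ 2 * (1 + d)), ?_, ?_⟩
  · rw [lt_min_iff]
    constructor
    · rw [hq]; nlinarith
    · nlinarith [mul_pos (pow_pos hr 2) hd0]
  intro φ ζ₁ ζ₂ hφ hφ' hζ₁ hζ₂ h0 h1 h2 h3
  rw [mem_uD] at hζ₁ hζ₂
  obtain ⟨h, hh, he⟩ := double_zero hφ hφ' ha hζ₁ h1 h3
  obtain ⟨-, hn⟩ := double_zero_norm hh h0 he
  obtain ⟨g, hg, hfg⟩ := Schur.divide (f := φ)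
    ⟨hφ, fun z hz => (mem_uD.1 (hφ' z hz)).le⟩ (ξ := 0) (by simp) h0
  have g1 := congrArg norm (hfg ζ₁ (mem_uD.2 hζ₁))
  have g2 := congrArg norm (hfg ζ₂ (mem_uD.2 hζ₂))
  rw [norm_mul, h1] at g1
  rw [norm_mul, h2, norm_neg] at g2
  have m0 : ∀ z : ℂ, ‖mobius 0 z‖ = ‖z‖ := fun z => by simp [mobius]
  rw [m0] at g1 g2
  have b1 := hg.2 ζ₁ (mem_uD.2 hζ₁)
  have b2 := hg.2 ζ₂ (mem_uD.2 hζ₂)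
  rw [← hrdef] at g1 g2 hn
  have n1 := norm_nonneg ζ₁
  have n2 := norm_nonneg ζ₂
  have k1 := norm_nonneg (g ζ₁)
  have k2 := norm_nonneg (g ζ₂)
  have hz2 : r ≤ ‖ζ₂‖ := by nlinarith only [n2, b2, g2]
  by_cases c1 : R < ‖ζ₁‖
  · refine (min_le_left _ _).trans ?_
    have : q ≤ ‖ζ₁‖ * ‖ζ₁‖ := by
      rw [← hR2, pow_two]; gcongr
    rw [mul_comm r q]
    exact mul_le_mul this hz2 hr.le (by positivity)
  by_cases c2 : R < ‖ζ₂‖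
  · refine (min_le_left _ _).trans ?_
    have : q ≤ ‖ζ₂‖ := by
      rw [← hR2]; nlinarith only [hR0, hR1, c2]
    exact mul_le_mul (by rw [← pow_two]; exact hn) this hq0.le (by positivity)
  push Not at c1 c2
  refine (min_le_right _ _).trans ?_
  have H1 := hg.harnack0 hR1 c1
  have H2 := hg.harnack0' hR1 c2
  have e1 : ‖g ζ₁‖ ^ 2 ≤ r := by
    by_contra hc
    push Not at hc
    have : r * r < ‖ζ₁‖ ^ 2 * ‖g ζ₁‖ ^ 2 := by nlinarith only [hc, hn, hr]
    have : ‖ζ₁‖ ^ 2 * ‖g ζ₁‖ ^ 2 = r * r := by rw [← mul_pow, ← g1]; ring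
    linarith
  have e2 : (1 - r) / 2 ≤ 1 - ‖g ζ₁‖ := by nlinarith only [e1, k1, b1]
  have e3 : (1 - R) ^ 2 * (1 - ‖g ζ₁‖) ≤ 4 * (1 - ‖g ζ₂‖) := by
    have s1 : (1 - R) * ((1 - R) * (1 - ‖g ζ₁‖)) ≤ (1 - R) * ((1 + R) * (1 - ‖g 0‖)) :=
      mul_le_mul_of_nonneg_left H1 (by linarith)
    have s2 : (1 + R) * ((1 - R) * (1 - ‖g 0‖)) ≤ (1 + R) * ((1 + R) * (1 - ‖g ζ₂‖)) :=
      mul_le_mul_of_nonneg_left H2 (by linarith)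
    have s3 : (1 + R) * (1 + R) ≤ 4 := by nlinarith only [hR0, hR1]
    have s4 : (1 + R) * (1 + R) * (1 - ‖g ζ₂‖) ≤ 4 * (1 - ‖g ζ₂‖) :=
      mul_le_mul_of_nonneg_right s3 (by linarith)
    nlinarith only [s1, s2, s4]
  have e4 : d ≤ 1 - ‖g ζ₂‖ := by
    have := mul_le_mul_of_nonneg_left e2 (sq_nonneg (1 - R))
    rw [hd]; linarith
  have e5 : r * (1 + d) ≤ ‖ζ₂‖ := by nlinarith only [e4, g2, hz2, hd0, n2]
  have e6 : r ≤ ‖ζ₁‖ * ‖ζ₁‖ := by rw [← pow_two]; exact hn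
  calc r ^ 2 * (1 + d) = r * (r * (1 + d)) := by ring
    _ ≤ ‖ζ₁‖ * ‖ζ₁‖ * ‖ζ₂‖ := mul_le_mul e6 e5 (by positivity) (by positivity)

set_option maxHeartbeats 2000000 in
theorem lower_VV {a : ℂ} (ha : ‖a‖ < 1) (ha0 : a ≠ 0) :
    ∃ M : ℝ, ‖a‖ ^ 2 < M ∧ ∀ (φ : ℂ → ℂ) (ζ₁ ζ₂ : ℂ), DifferentiableOn ℂ φ unitDisc →
      (∀ w ∈ unitDisc, φ w ∈ unitDisc) → ζ₁ ∈ unitDisc → ζ₂ ∈ unitDisc → φ 0 = 0 →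
      φ ζ₁ = a → φ ζ₂ = -a → deriv φ ζ₁ = 0 → deriv φ ζ₂ = 0 →
      M ≤ ‖ζ₁‖ * ‖ζ₁‖ * ‖ζ₂‖ * ‖ζ₂‖ := by
  have hr : 0 < ‖a‖ := norm_pos_iff.2 ha0
  set r := ‖a‖ with hrdef
  set q := (1 + r) / 2 with hq
  set R := √q with hR
  have hq1 : q < 1 := by rw [hq]; linarith
  have hq0 : 0 < q := by rw [hq]; linarith
  have hR0 : 0 < R := Real.sqrt_pos.2 hq0
  have hR2 : R ^ 2 = q := Real.sq_sqrt hq0.le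
  have hR1 : R < 1 := by nlinarith
  set c := (1 - q) ^ 2 / 4 with hc
  have hqq : 0 < 1 - q := by linarith
  have hc0 : 0 < c := by positivity
  have hc1 : c ≤ 1 := by rw [hc]; nlinarith
  have hRR : 0 < 1 - R := by linarith
  set d := (1 - R) * c / 4 with hd
  have hd0 : 0 < d := by positivity
  refine ⟨min (r * q) (r ^ 2 * (1 + d)), ?_, ?_⟩
  · rw [lt_min_iff]
    constructor
    · rw [hq]; nlinarith
    · nlinarith [mul_pos (pow_pos hr 2) hd0]
  intro φ ζ₁ ζ₂ hφ hφ' hζ₁ hζ₂ h0 h1 h2 h3 h4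
  rw [mem_uD] at hζ₁ hζ₂
  obtain ⟨h, hh, he⟩ := double_zero hφ hφ' ha hζ₁ h1 h3
  obtain ⟨hn', hn⟩ := double_zero_norm hh h0 he
  obtain ⟨k, hk, hke⟩ := double_zero hφ hφ' (a := -a) (by simpa using ha) hζ₂ h2 h4
  obtain ⟨-, kn⟩ := double_zero_norm hk h0 hke
  rw [norm_neg] at kn
  rw [← hrdef] at hn hn' kn
  have n1 := norm_nonneg ζ₁
  have n2 := norm_nonneg ζ₂
  have P : ‖ζ₁‖ * ‖ζ₁‖ * ‖ζ₂‖ * ‖ζ₂‖ = ‖ζ₁‖ ^ 2 * ‖ζ₂‖ ^ 2 := by ring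
  rw [P]
  by_cases c1 : R < ‖ζ₁‖
  · refine (min_le_left _ _).trans ?_
    have : q ≤ ‖ζ₁‖ ^ 2 := by
      rw [← hR2]; gcongr
    rw [mul_comm r q]
    exact mul_le_mul this kn hr.le (by positivity)
  by_cases c2 : R < ‖ζ₂‖
  · refine (min_le_left _ _).trans ?_
    have : q ≤ ‖ζ₂‖ ^ 2 := by
      rw [← hR2]; gcongr
    exact mul_le_mul hn this hq0.le (by positivity)
  push Not at c1 c2
  refine (min_le_right _ _).trans ?_
  -- derivative relation at ζ₂
  have hne : mobius ζ₁ ζ₂ ≠ 0 := by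
    intro hz
    have := mob_eq_zero hζ₁ hζ₂ hz
    rw [this, h1] at h2
    apply ha0
    linear_combination h2 / 2
  have d1 := ((mob_hasDeriv hζ₁ hζ₂.le).pow 2).mul (hh.hasDeriv hζ₂)
  have d2 : HasDerivAt φ 0 ζ₂ := by
    rw [← h4]
    exact (hφ.differentiableAt (uD_nhds (mem_uD.2 hζ₂))).hasDerivAt
  have d3 := (mob_hasDeriv (z := φ ζ₂) ha (by rw [h2, norm_neg]; exact ha.le)).comp ζ₂ d2
  have d4 : (mobius a ∘ φ) =ᶠ[𝓝 ζ₂] (mobius ζ₁ ^ 2 * h) := by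
    filter_upwards [uD_nhds (mem_uD.2 hζ₂)] with z hz using he z hz
  have d5 := (d1.congr_of_eventuallyEq d4).unique d3
  set m' := ((‖ζ₁‖ ^ 2 - 1 : ℝ) : ℂ) / (1 - (starRingEnd ℂ) ζ₁ * ζ₂) ^ 2 with hm'
  have d6 : 2 * m' * h ζ₂ = - (mobius ζ₁ ζ₂ * deriv h ζ₂) := by
    apply mul_left_cancel₀ hne
    simp at d5
    linear_combination d5
  have d7 := congrArg norm d6
  rw [norm_neg, norm_mul, norm_mul, norm_mul, Complex.norm_two] at d7
  have d8 : (1 - q) / 4 ≤ ‖m'‖ := by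
    have hD := norm_pos_iff.2 (mob_den hζ₁ hζ₂.le)
    have hD2 : ‖1 - (starRingEnd ℂ) ζ₁ * ζ₂‖ ≤ 2 := by
      refine (norm_sub_le _ _).trans ?_
      rw [norm_mul, RCLike.norm_conj, norm_one]
      nlinarith only [n1, n2, hζ₁, hζ₂]
    have : 0 ≤ 1 - ‖ζ₁‖ ^ 2 := by nlinarith only [n1, hζ₁]
    rw [hm', norm_div, norm_pow, Complex.norm_real, norm_sub_rev, Real.norm_of_nonneg this,
      div_le_div_iff₀ (by norm_num) (by positivity)]
    have u1 : 1 - q ≤ 1 - ‖ζ₁‖ ^ 2 := by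
      rw [← hR2]; gcongr
    have u2 : ‖1 - (starRingEnd ℂ) ζ₁ * ζ₂‖ ^ 2 ≤ 4 := by nlinarith only [hD, hD2]
    exact mul_le_mul u1 u2 (by positivity) (by linarith)
  have d9 := hh.pick hζ₂
  have b2 := hh.2 ζ₂ (mem_uD.2 hζ₂)
  have k2 := norm_nonneg (h ζ₂)
  have m1 := (mob_lt hζ₁ hζ₂).le
  have d10 : 2 * ((1 - q) / 4) * ‖h ζ₂‖ ≤ ‖deriv h ζ₂‖ := by
    have := norm_nonneg (deriv h ζ₂)
    calc _ ≤ 2 * ‖m'‖ * ‖h ζ₂‖ := by gcongr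
      _ = _ := d7
      _ ≤ 1 * ‖deriv h ζ₂‖ := by gcongr
      _ = _ := one_mul _
  have d11 : ‖deriv h ζ₂‖ * (1 - q) ≤ 1 - ‖h ζ₂‖ ^ 2 := by
    have : 1 - q ≤ 1 - ‖ζ₂‖ ^ 2 := by
      rw [← hR2]; gcongr
    exact (mul_le_mul_of_nonneg_left this (norm_nonneg _)).trans d9
  have d12 : c * ‖h ζ₂‖ ≤ 1 - ‖h ζ₂‖ := by
    have := mul_le_mul_of_nonneg_right d10 hqq.le
    rw [hc]
    nlinarith only [this, d11, k2, b2]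
  have d13 : c / 2 ≤ 1 - ‖h ζ₂‖ := by nlinarith only [d12, hc0, hc1, k2, b2]
  have H1 := hh.harnack0 hR1 c2
  have b0 := hh.2 0 zero_uD
  have d14 : d ≤ 1 - ‖h 0‖ := by
    have : (1 - R) * (c / 2) ≤ (1 - R) * (1 - ‖h ζ₂‖) := by gcongr
    rw [hd]
    nlinarith only [this, H1, b0, hR1]
  have e5 : r * (1 + d) ≤ ‖ζ₁‖ ^ 2 := by nlinarith only [d14, hn, hn', hd0, sq_nonneg ‖ζ₁‖]
  calc r ^ 2 * (1 + d) = r * (1 + d) * r := by ring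
    _ ≤ ‖ζ₁‖ ^ 2 * ‖ζ₂‖ ^ 2 := mul_le_mul e5 kn (by positivity) (by positivity)

theorem lower_00 {φ : ℂ → ℂ} {ζ₁ ζ₂ : ℂ} (hφ : DifferentiableOn ℂ φ unitDisc)
    (hφ' : ∀ w ∈ unitDisc, φ w ∈ unitDisc) (hζ₁ : ζ₁ ∈ unitDisc) (hζ₂ : ζ₂ ∈ unitDisc)
    (hne : ζ₁ ≠ ζ₂) (h1 : φ ζ₁ = 0) (h2 : φ ζ₂ = 0) : ‖φ 0‖ ≤ ‖ζ₁‖ * ‖ζ₂‖ := by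
  rw [mem_uD] at hζ₁ hζ₂
  obtain ⟨g, hg, hfg⟩ := Schur.divide (f := φ)
    ⟨hφ, fun z hz => (mem_uD.1 (hφ' z hz)).le⟩ hζ₁ h1
  have e := hfg ζ₂ (mem_uD.2 hζ₂)
  rw [h2] at e
  have g2 : g ζ₂ = 0 := by
    rcases mul_eq_zero.1 e.symm with h | h
    · exact absurd (mob_eq_zero hζ₁ hζ₂ h).symm hne
    · exact h
  obtain ⟨k, hk, hgk⟩ := hg.divide hζ₂ g2
  rw [hfg 0 zero_uD, hgk 0 zero_uD, mob_zero, mob_zero, norm_mul, norm_mul]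
  have := hk.2 0 zero_uD
  gcongr
  exact mul_le_of_le_one_right (norm_nonneg _) this

theorem elog_add {x y : ℝ} (hx : 0 ≤ x) (hy : 0 ≤ y) : elog x + elog y = elog (x * y) := by
  unfold elog
  by_cases h1 : x = 0
  · simp [h1]
  by_cases h2 : y = 0
  · simp [h2]
  simp only [h1, h2, mul_eq_zero, or_self, if_false]
  rw [Real.log_mul h1 h2]
  simp

theorem elog_mono {x y : ℝ} (hx : 0 < x) (hy : x ≤ y) : elog x ≤ elog y := by
  unfold elog
  rw [if_neg hx.ne', if_neg (hx.trans_le hy).ne']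
  exact_mod_cast Real.log_le_log hx hy

theorem elog_lt {x y : ℝ} (hx : 0 < x) (hy : x < y) : elog x < elog y := by
  unfold elog
  rw [if_neg hx.ne', if_neg (hx.trans hy).ne']
  exact_mod_cast Real.log_lt_log hx hy

theorem lower_all {a γ : ℂ} (ha : a ∈ unitDisc) (ha0 : a ≠ 0) (h1 : ‖a‖ ^ 2 < ‖γ‖) :
    ∃ M : ℝ, ‖a‖ ^ 2 < M ∧
      elog M ≤ min (min (La0b0 a (-a) (0, γ)) (LaVb0 a (-a) (0, γ)))
            (min (La0bV a (-a) (0, γ)) (LaVbV a (-a) (0, γ))) := by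
  have ha' := mem_uD.1 ha
  obtain ⟨M₁, hM₁, H₁⟩ := lower_V0 ha' ha0
  obtain ⟨M₂, hM₂, H₂⟩ := lower_V0 (a := -a) (by simpa using ha') (by simpa using ha0)
  obtain ⟨M₃, hM₃, H₃⟩ := lower_VV ha' ha0
  rw [norm_neg] at hM₂
  set M := min (min ‖γ‖ M₁) (min M₂ M₃) with hM
  have hM0 : ‖a‖ ^ 2 < M := by simp [hM, lt_min_iff, *]
  have hMp : 0 < M := (sq_nonneg ‖a‖).trans_lt hM0
  refine ⟨M, hM0, ?_⟩
  have l0 : M ≤ ‖γ‖ := (min_le_left _ _).trans (min_le_left _ _)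
  have l1 : M ≤ M₁ := (min_le_left _ _).trans (min_le_right _ _)
  have l2 : M ≤ M₂ := (min_le_right _ _).trans (min_le_left _ _)
  have l3 : M ≤ M₃ := (min_le_right _ _).trans (min_le_right _ _)
  refine le_min (le_min ?_ ?_) (le_min ?_ ?_)
  · refine le_sInf ?_
    rintro t ⟨φ₁, φ₂, ζ₁, ζ₂, ⟨A1, A2, A3, A4⟩, z1, z2, i1, i2, j1, j2, j3, j4, rfl⟩
    rw [elog_add (norm_nonneg _) (norm_nonneg _)]
    refine elog_mono hMp (l0.trans ?_)
    have hne : ζ₁ ≠ ζ₂ := by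
      intro h
      rw [h, j3] at j1
      apply ha0
      linear_combination -j1 / 2
    have := lower_00 A2 A4 z1 z2 hne j2 j4
    rwa [i2] at this
  · refine le_sInf ?_
    rintro t ⟨φ₁, φ₂, ζ₁, ζ₂, ⟨A1, A2, A3, A4⟩, z1, z2, i1, i2, j1, j2, j3, j4, j5, rfl⟩
    rw [elog_add (norm_nonneg _) (norm_nonneg _), elog_add (by positivity) (norm_nonneg _)]
    exact elog_mono hMp (l1.trans (H₁ φ₁ ζ₁ ζ₂ A1 A3 z1 z2 i1 j1 j3 j5))
  · refine le_sInf ?_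
    rintro t ⟨φ₁, φ₂, ζ₁, ζ₂, ⟨A1, A2, A3, A4⟩, z1, z2, i1, i2, j1, j2, j3, j4, j5, rfl⟩
    rw [elog_add (norm_nonneg _) (norm_nonneg _), elog_add (by positivity) (norm_nonneg _)]
    refine elog_mono hMp (l2.trans ((H₂ φ₁ ζ₂ ζ₁ A1 A3 z2 z1 i1 j3 (by simpa using j1) j5).trans_eq
      (by ring)))
  · refine le_sInf ?_
    rintro t ⟨φ₁, φ₂, ζ₁, ζ₂, ⟨A1, A2, A3, A4⟩, z1, z2, i1, i2, j1, j2, j3, j4, j5, j6, rfl⟩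
    rw [elog_add (norm_nonneg _) (norm_nonneg _), elog_add (by positivity) (norm_nonneg _),
      elog_add (by positivity) (norm_nonneg _)]
    exact elog_mono hMp (l3.trans (H₃ φ₁ ζ₁ ζ₂ A1 A3 z1 z2 i1 j1 j3 j5 j6))

theorem elog_mono' {x y : ℝ} (hx : 0 ≤ x) (hy : x ≤ y) : elog x ≤ elog y := by
  rcases hx.eq_or_lt with h | h
  · subst h; simp [elog]
  · exact elog_mono h hy

theorem sup_lt {F : ℂ → ℂ} {t : ℝ} (ht0 : 0 < t) (ht1 : t < 1)
    (hF : DifferentiableOn ℂ F unitDisc) (hF' : ∀ z ∈ unitDisc, ‖F z‖ < 1) :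
    ∃ s < 1, ∀ z, ‖z‖ ≤ t → ‖F z‖ ≤ s := by
  have hsub : closedBall (0 : ℂ) t ⊆ unitDisc := closedBall_subset_ball ht1
  obtain ⟨w, hw, hmax⟩ := (isCompact_closedBall (0 : ℂ) t).exists_isMaxOn
    ⟨0, by simp [ht0.le]⟩ ((hF.continuousOn.mono hsub).norm)
  exact ⟨‖F w‖, hF' w (hsub hw), fun z hz => hmax (by simpa using hz)⟩

theorem bdd_poly {P : ℂ → ℂ} (hP : Continuous P) (t : ℝ) :
    ∃ C, 0 < C ∧ ∀ z, ‖z‖ ≤ t → ‖P z‖ ≤ C := by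
  obtain ⟨C, hC⟩ := (isCompact_closedBall (0 : ℂ) t).exists_bound_of_continuousOn hP.continuousOn
  exact ⟨max C 1, by simp, fun z hz => (hC z (by simpa using hz)).trans (le_max_left _ _)⟩

theorem upper_pert {a γ p q₁ q₂ D : ℂ} {t M : ℝ} {F₁ F₂ : ℂ → ℂ}
    (ht1 : t < 1) (hp : ‖p‖ < t) (hq₁ : ‖q₁‖ < t) (hq₂ : ‖q₂‖ < t)
    (hp0 : p ≠ 0) (hq₂0 : q₂ ≠ 0) (hpq₁ : p ≠ q₁) (hpq₂ : p ≠ q₂)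
    (hqq : q₁ ≠ q₂)
    (dF₁ : DifferentiableOn ℂ F₁ unitDisc) (mF₁ : ∀ z ∈ unitDisc, ‖F₁ z‖ < 1)
    (dF₂ : DifferentiableOn ℂ F₂ unitDisc) (mF₂ : ∀ z ∈ unitDisc, ‖F₂ z‖ < 1)
    (F₁0 : F₁ 0 = 0) (F₁p : F₁ p = a) (F₁p' : HasDerivAt F₁ 0 p) (F₁q₁ : F₁ q₁ = -a)
    (F₁q₂ : F₁ q₂ = -a)
    (F₂0 : F₂ 0 = γ) (F₂p : F₂ p = 0) (F₂p' : HasDerivAt F₂ D p) (F₂q₁ : F₂ q₁ = 0)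
    (F₂q₂ : F₂ q₂ = 0) (hD : D ≠ 0)
    (hM : ‖p‖ / t * (‖q₁‖ / t) * (‖q₂‖ / t) * (‖p‖ / t) < M) :
    ∀ᶠ ε in 𝓝[≠] (0 : ℂ), Leps4 a (-a) ε (0, γ) ≤ elog M := by
  have ht0 : 0 < t := (norm_nonneg p).trans_lt hp
  obtain ⟨s₁, hs₁, hb₁⟩ := sup_lt ht0 ht1 dF₁ mF₁
  obtain ⟨s₂, hs₂, hb₂⟩ := sup_lt ht0 ht1 dF₂ mF₂
  set P : ℂ → ℂ := fun z => z * (z - p) * (z - q₁) * (z - q₂) with hP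
  set X : ℂ → ℂ := fun z => z * (z - p) * (z - q₁) / (q₂ * (q₂ - p) * (q₂ - q₁)) with hX
  have P0 : P 0 = 0 := by simp [hP]
  have Pp : P p = 0 := by simp [hP]
  have Pq₁ : P q₁ = 0 := by simp [hP]
  have Pq₂ : P q₂ = 0 := by simp [hP]
  have X0 : X 0 = 0 := by simp [hX]
  have Xp : X p = 0 := by simp [hX]
  have Xq₁ : X q₁ = 0 := by simp [hX]
  have Xq₂ : X q₂ = 1 := by
    have h1 : q₂ - p ≠ 0 := sub_ne_zero.2 hpq₂.symm
    have h2 : q₂ - q₁ ≠ 0 := sub_ne_zero.2 hqq.symm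
    simp only [hX]
    exact div_self (mul_ne_zero (mul_ne_zero hq₂0 h1) h2)
  have dP : Differentiable ℂ P := by simp only [hP]; fun_prop
  have dX : Differentiable ℂ X := by simp only [hX]; fun_prop
  obtain ⟨C, hC0, hC⟩ := bdd_poly dP.continuous t
  obtain ⟨C', hC'0, hC'⟩ := bdd_poly dX.continuous t
  -- the direction parameter
  have hη : Tendsto (fun ε : ℂ => ε / D) (𝓝[≠] 0) (𝓝[≠] 0) := by
    refine tendsto_nhdsWithin_of_tendsto_nhds_of_eventually_within _ ?_ ?_
    · have : Tendsto (fun ε : ℂ => ε / D) (𝓝 0) (𝓝 (0 / D)) := tendsto_id.div_const D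
      rw [zero_div] at this
      exact this.mono_left nhdsWithin_le_nhds
    · filter_upwards [self_mem_nhdsWithin] with ε hε
      exact div_ne_zero hε hD
  set E : ℂ := p * (p - q₁) * (p - q₂) with hE
  have hE0 : E ≠ 0 := mul_ne_zero (mul_ne_zero hp0 (sub_ne_zero.2 hpq₁)) (sub_ne_zero.2 hpq₂)
  set Q : ℂ → ℂ := fun η => (p + η) * (p + η - q₁) * (p + η - q₂) with hQ
  have PQ : ∀ η, P (p + η) = η * Q η := fun η => by simp only [hP, hQ]; ring
  have tQ : Tendsto Q (𝓝[≠] 0) (𝓝 E) := by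
    have : Continuous Q := by simp only [hQ]; fun_prop
    have h := this.tendsto 0
    simp only [hQ, add_zero] at h
    exact h.mono_left nhdsWithin_le_nhds
  have tQ0 : ∀ᶠ η in 𝓝[≠] (0 : ℂ), Q η ≠ 0 := tQ.eventually_ne hE0
  have t1 : Tendsto (fun η => (a - F₁ (p + η)) / P (p + η)) (𝓝[≠] 0) (𝓝 0) := by
    have h1 := F₁p'.tendsto_slope_zero
    have h2 := h1.neg.div tQ hE0
    simp only [neg_zero, zero_div] at h2
    refine h2.congr' ?_
    filter_upwards [self_mem_nhdsWithin] with η hη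
    rw [PQ, F₁p]
    have : η ≠ 0 := hη
    change -(η⁻¹ * (F₁ (p + η) - a)) / Q η = _ / (η * Q η)
    rw [div_mul_eq_div_div _ η (Q η)]
    congr 1
    rw [eq_div_iff this]
    linear_combination (a - F₁ (p + η)) * inv_mul_cancel₀ this
  have t2 : Tendsto (fun η => (D * η - F₂ (p + η) - D * η * X (p + η)) / P (p + η))
      (𝓝[≠] 0) (𝓝 0) := by
    have h1 := F₂p'.tendsto_slope_zero
    have hx : Tendsto (fun η => X (p + η)) (𝓝[≠] 0) (𝓝 0) := by
      have : Continuous (fun η => X (p + η)) := dX.continuous.comp (by fun_prop)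
      have h := this.tendsto 0
      simp only [add_zero, Xp] at h
      exact h.mono_left nhdsWithin_le_nhds
    have h2 := (((tendsto_const_nhds (x := D)).sub h1).sub (hx.const_mul D)).div tQ hE0
    simp only [sub_self, mul_zero, zero_div] at h2
    refine h2.congr' ?_
    filter_upwards [self_mem_nhdsWithin] with η hη
    rw [PQ, F₂p]
    have : η ≠ 0 := hη
    change (D - η⁻¹ * (F₂ (p + η) - 0) - D * X (p + η)) / Q η = _ / (η * Q η)
    rw [div_mul_eq_div_div _ η (Q η)]
    congr 1
    rw [eq_div_iff this]
    linear_combination -F₂ (p + η) * inv_mul_cancel₀ this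
  have t1' := t1.comp hη
  have t2' := t2.comp hη
  have b1 : ∀ᶠ ε in 𝓝[≠] (0 : ℂ), ‖(a - F₁ (p + ε / D)) / P (p + ε / D)‖ * C < 1 - s₁ := by
    have h := t1'.norm.mul_const C
    simp only [norm_zero, zero_mul] at h
    exact h.eventually_lt_const (by linarith)
  have b2 : ∀ᶠ ε in 𝓝[≠] (0 : ℂ), ‖ε‖ * C' + ‖(D * (ε / D) - F₂ (p + ε / D)
      - D * (ε / D) * X (p + ε / D)) / P (p + ε / D)‖ * C < 1 - s₂ := by
    have h0 : Tendsto (fun ε : ℂ => ε) (𝓝[≠] 0) (𝓝 0) := nhdsWithin_le_nhds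
    have h := (h0.norm.mul_const C').add (t2'.norm.mul_const C)
    simp only [norm_zero, zero_mul, add_zero] at h
    exact h.eventually_lt_const (by linarith)
  have hη0 : Tendsto (fun ε : ℂ => p + ε / D) (𝓝[≠] 0) (𝓝 p) := by
    have := (hη.mono_right nhdsWithin_le_nhds).const_add p
    simpa using this
  have b3 : ∀ᶠ ε in 𝓝[≠] (0 : ℂ), ‖p + ε / D‖ < t := hη0.norm.eventually_lt_const hp
  have b4 : ∀ᶠ ε in 𝓝[≠] (0 : ℂ),
      ‖p‖ / t * (‖q₁‖ / t) * (‖q₂‖ / t) * (‖p + ε / D‖ / t) < M :=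
    ((hη0.norm.div_const t).const_mul _).eventually_lt_const hM
  filter_upwards [b1, b2, b3, b4, hη.eventually tQ0, self_mem_nhdsWithin]
    with ε c1 c2 c3 c4 c5 c6
  have hε : ε ≠ 0 := c6
  have hDε : D * (ε / D) = ε := mul_div_cancel₀ _ hD
  set η := ε / D with hηd
  have hη0 : η ≠ 0 := div_ne_zero hε hD
  have hPη : P (p + η) ≠ 0 := by rw [PQ]; exact mul_ne_zero hη0 c5
  rw [hDε] at c2
  set κ₁ := (a - F₁ (p + η)) / P (p + η) with hκ₁
  set κ₂ := (ε - F₂ (p + η) - ε * X (p + η)) / P (p + η) with hκ₂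
  have hκ₁' : κ₁ * P (p + η) = a - F₁ (p + η) := div_mul_cancel₀ _ hPη
  have hκ₂' : κ₂ * P (p + η) = ε - F₂ (p + η) - ε * X (p + η) := div_mul_cancel₀ _ hPη
  have htc : (t : ℂ) ≠ 0 := by exact_mod_cast ht0.ne'
  have nt : ∀ w : ℂ, ‖w / (t : ℂ)‖ = ‖w‖ / t := fun w => by
    rw [norm_div, Complex.norm_real, Real.norm_of_nonneg ht0.le]
  have mt : ∀ w : ℂ, ‖w‖ < t → w / (t : ℂ) ∈ unitDisc := fun w hw => by
    rw [mem_uD, nt, div_lt_one ht0]; exact hw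
  have ct : ∀ w : ℂ, (t : ℂ) * (w / (t : ℂ)) = w := fun w => mul_div_cancel₀ _ htc
  have lt : ∀ w ∈ unitDisc, ‖(t : ℂ) * w‖ ≤ t := fun w hw => by
    rw [norm_mul, Complex.norm_real, Real.norm_of_nonneg ht0.le]
    have := mem_uD.1 hw
    nlinarith
  have dt : DifferentiableOn ℂ (fun w : ℂ => (t : ℂ) * w) unitDisc := by fun_prop
  have mapt : Set.MapsTo (fun w : ℂ => (t : ℂ) * w) unitDisc unitDisc := fun w hw =>
    mem_uD.2 ((lt w hw).trans_lt ht1)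
  refine le_trans (sInf_le ⟨fun w => F₁ (t * w) + κ₁ * P (t * w),
    fun w => F₂ (t * w) + ε * X (t * w) + κ₂ * P (t * w), p / t, q₁ / t, q₂ / t, (p + η) / t,
    ⟨?_, ?_, ?_, ?_⟩, mt _ hp, mt _ hq₁, mt _ hq₂, mt _ c3, ?_, ?_, ?_, ?_, ?_, ?_, ?_, ?_, ?_, ?_,
    rfl⟩) ?_
  · exact (dF₁.comp dt mapt).add ((dP.differentiableOn.comp dt mapt).const_mul κ₁)
  · exact ((dF₂.comp dt mapt).add ((dX.differentiableOn.comp dt mapt).const_mul ε)).add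
      ((dP.differentiableOn.comp dt mapt).const_mul κ₂)
  · intro w hw
    have hw' := lt w hw
    rw [mem_uD]
    calc ‖F₁ (t * w) + κ₁ * P (t * w)‖ ≤ ‖F₁ (t * w)‖ + ‖κ₁‖ * ‖P (t * w)‖ := by
          rw [← norm_mul]; exact norm_add_le _ _
      _ ≤ s₁ + ‖κ₁‖ * C := by
          gcongr
          · exact hb₁ _ hw'
          · exact hC _ hw'
      _ < 1 := by linarith
  · intro w hw
    have hw' := lt w hw
    rw [mem_uD]
    calc ‖F₂ (t * w) + ε * X (t * w) + κ₂ * P (t * w)‖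
        ≤ ‖F₂ (t * w)‖ + ‖ε‖ * ‖X (t * w)‖ + ‖κ₂‖ * ‖P (t * w)‖ := by
          rw [← norm_mul, ← norm_mul]; exact norm_add₃_le
      _ ≤ s₂ + ‖ε‖ * C' + ‖κ₂‖ * C := by
          gcongr
          · exact hb₂ _ hw'
          · exact hC' _ hw'
          · exact hC _ hw'
      _ < 1 := by linarith
  · simp [F₁0, P0]
  · simp [F₂0, P0, X0]
  · simp only [ct]; simp [F₁p, Pp]
  · simp only [ct]; simp [F₂p, Pp, Xp]
  · simp only [ct]; simp [F₁q₁, Pq₁]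
  · simp only [ct]; simp [F₂q₁, Pq₁, Xq₁]
  · simp only [ct]; simp [F₁q₂, Pq₂]
  · simp only [ct]; simp [F₂q₂, Pq₂, Xq₂]
  · simp only [ct]; rw [hκ₁']; ring
  · simp only [ct]; rw [hκ₂']; ring
  · rw [elog_add (norm_nonneg _) (norm_nonneg _), elog_add (by positivity) (norm_nonneg _),
      elog_add (by positivity) (norm_nonneg _)]
    refine elog_mono' (by positivity) ?_
    rw [nt, nt, nt, nt]
    exact c4.le

theorem mob_real (r z : ℂ) (hr : (starRingEnd ℂ) r = r) : mobius r z = (r - z) / (1 - r * z) := by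
  rw [mobius, hr]

theorem upper_all {a γ : ℂ} {M : ℝ} (ha : ‖a‖ < 1) (ha0 : a ≠ 0) (hγ0 : γ ≠ 0)
    (h2 : ‖γ‖ ≤ ‖a‖ ^ ((3 : ℝ) / 2)) (hM : ‖a‖ ^ 2 < M) :
    ∀ᶠ ε in 𝓝[≠] (0 : ℂ), Leps4 a (-a) ε (0, γ) ≤ elog M := by
  have hr : 0 < ‖a‖ := norm_pos_iff.2 ha0
  obtain ⟨r, hrdef⟩ : ∃ r, r = ‖a‖ := ⟨_, rfl⟩
  rw [← hrdef] at ha hr h2 hM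
  have hrc : (r : ℂ) ≠ 0 := by exact_mod_cast hr.ne'
  obtain ⟨u, hu⟩ : ∃ u : ℂ, u = a / r := ⟨_, rfl⟩
  have hur : u * r = a := by rw [hu]; exact div_mul_cancel₀ _ hrc
  have hun : ‖u‖ = 1 := by
    rw [hu, norm_div, Complex.norm_real, Real.norm_of_nonneg hr.le, ← hrdef, div_self hr.ne']
  have hnr : ‖(r : ℂ)‖ < 1 := by rwa [Complex.norm_real, Real.norm_of_nonneg hr.le]
  -- p
  obtain ⟨pr, hpr⟩ : ∃ x, x = √r := ⟨_, rfl⟩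
  have hpr0 : 0 < pr := by rw [hpr]; exact Real.sqrt_pos.2 hr
  have hpr2 : pr ^ 2 = r := by rw [hpr]; exact Real.sq_sqrt hr.le
  have hpr1 : pr < 1 := by nlinarith
  obtain ⟨p, hp⟩ : ∃ p : ℂ, p = (pr : ℂ) := ⟨_, rfl⟩
  have hpn : ‖p‖ = pr := by rw [hp, Complex.norm_real, Real.norm_of_nonneg hpr0.le]
  have hp1 : ‖p‖ < 1 := by rwa [hpn]
  have hp2 : p ^ 2 = r := by rw [hp, ← hpr2]; push_cast; ring
  have hp0 : p ≠ 0 := norm_pos_iff.1 (by rwa [hpn])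
  -- σ
  obtain ⟨sr, hsr⟩ : ∃ x, x = √(2 * r / (1 + r ^ 2)) := ⟨_, rfl⟩
  have hs0 : 0 < 2 * r / (1 + r ^ 2) := by positivity
  have hsr0 : 0 < sr := by rw [hsr]; exact Real.sqrt_pos.2 hs0
  have hsr2 : sr ^ 2 = 2 * r / (1 + r ^ 2) := by rw [hsr]; exact Real.sq_sqrt hs0.le
  have hsr1 : sr < 1 := by
    have : sr ^ 2 < 1 := by
      rw [hsr2, div_lt_one (by positivity)]
      nlinarith [mul_pos (sub_pos.2 ha) (sub_pos.2 ha)]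
    nlinarith
  obtain ⟨σ, hσ⟩ : ∃ p : ℂ, p = (sr : ℂ) := ⟨_, rfl⟩
  have hσn : ‖σ‖ = sr := by rw [hσ, Complex.norm_real, Real.norm_of_nonneg hsr0.le]
  have hσ1 : ‖σ‖ < 1 := by rwa [hσn]
  have hσ1' : ‖-σ‖ < 1 := by rwa [norm_neg]
  have hσ0 : σ ≠ 0 := norm_pos_iff.1 (by rwa [hσn])
  have hr2c : (1 : ℂ) + (r : ℂ) ^ 2 ≠ 0 := by
    have : (1 + r ^ 2 : ℝ) ≠ 0 := by positivity
    exact_mod_cast this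
  have hσ2 : σ ^ 2 * (1 + (r : ℂ) ^ 2) = 2 * r := by
    have : sr ^ 2 * (1 + r ^ 2) = 2 * r := by rw [hsr2]; field_simp
    rw [hσ]
    exact_mod_cast this
  have hr2c' : (1 : ℂ) - (r : ℂ) ^ 2 ≠ 0 := by
    have : (1 - r ^ 2 : ℝ) ≠ 0 := by nlinarith
    exact_mod_cast this
  have den0 : 1 - (r : ℂ) * σ ^ 2 ≠ 0 := by
    intro h
    apply hr2c'
    linear_combination (1 + (r : ℂ) ^ 2) * h + r * hσ2
  have key : ((r : ℂ) - σ ^ 2) / (1 - r * σ ^ 2) = -r := by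
    rw [div_eq_iff den0]
    apply mul_right_cancel₀ hr2c
    linear_combination (-1 - (r : ℂ) ^ 2) * hσ2
  have keym : mobius (r : ℂ) (σ ^ 2) = -r := by
    rw [mob_real _ _ (Complex.conj_ofReal r), key]
  -- the points q
  obtain ⟨q₁, hq₁⟩ : ∃ q, q = mobius p σ := ⟨_, rfl⟩
  obtain ⟨q₂, hq₂⟩ : ∃ q, q = mobius p (-σ) := ⟨_, rfl⟩
  have hq₁1 : ‖q₁‖ < 1 := by rw [hq₁]; exact mob_lt hp1 hσ1
  have hq₂1 : ‖q₂‖ < 1 := by rw [hq₂]; exact mob_lt hp1 hσ1'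
  have mq₁ : mobius p q₁ = σ := by rw [hq₁]; exact mob_invol hp1 hσ1
  have mq₂ : mobius p q₂ = -σ := by rw [hq₂]; exact mob_invol hp1 hσ1'
  have hpconj : (starRingEnd ℂ) p = p := by rw [hp]; exact Complex.conj_ofReal _
  have hqq : q₁ * q₂ = -r := by
    rw [← key, hq₁, hq₂, mob_real _ _ hpconj, mob_real _ _ hpconj, div_mul_div_comm, ← hp2]
    congr 1 <;> ring
  have hq₁0 : q₁ ≠ 0 := fun h => by
    rw [h, zero_mul] at hqq; exact hrc (by linear_combination hqq)
  have hq₂0 : q₂ ≠ 0 := fun h => by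
    rw [h, mul_zero] at hqq; exact hrc (by linear_combination hqq)
  have hqn : ‖q₁‖ * ‖q₂‖ = r := by
    rw [← norm_mul, hqq, norm_neg, Complex.norm_real, Real.norm_of_nonneg hr.le]
  have hne : q₁ ≠ q₂ := by
    intro h
    rw [h, mq₂] at mq₁
    exact hσ0 (by linear_combination -mq₁ / 2)
  have hpq₁ : p ≠ q₁ := by
    intro h
    rw [← h, mob_self] at mq₁
    exact hσ0 mq₁.symm
  have hpq₂ : p ≠ q₂ := by
    intro h
    rw [← h, mob_self] at mq₂
    exact hσ0 (by linear_combination mq₂)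
  -- F₂
  obtain ⟨C, hC⟩ : ∃ C, C = γ / (p * q₁ * q₂) := ⟨_, rfl⟩
  have hpqq : p * q₁ * q₂ ≠ 0 := mul_ne_zero (mul_ne_zero hp0 hq₁0) hq₂0
  have hC0 : C ≠ 0 := by rw [hC]; exact div_ne_zero hγ0 hpqq
  have hC1 : ‖C‖ ≤ 1 := by
    rw [hC, norm_div]
    refine div_le_one_of_le₀ (h2.trans_eq ?_) (norm_nonneg _)
    rw [norm_mul, norm_mul, mul_assoc, hqn, hpn, hpr, Real.sqrt_eq_rpow]
    rw [show (3 : ℝ) / 2 = 1 / 2 + 1 by norm_num, Real.rpow_add_one hr.ne']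
  set G : ℂ → ℂ := fun z => C * mobius q₁ z * mobius q₂ z with hG
  have dG : DifferentiableOn ℂ G unitDisc :=
    ((mob_diffOn hq₁1).const_mul C).mul (mob_diffOn hq₂1)
  have mG : ∀ z ∈ unitDisc, ‖G z‖ ≤ 1 := fun z hz => by
    have a1 := (mob_lt hq₁1 (mem_uD.1 hz)).le
    have a2 := (mob_lt hq₂1 (mem_uD.1 hz)).le
    simp only [hG, norm_mul]
    exact mul_le_one₀ (mul_le_one₀ hC1 (norm_nonneg _) a1) (norm_nonneg _) a2
  have hGS : Schur G := ⟨dG, mG⟩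
  have Gp : G p ≠ 0 := by
    refine mul_ne_zero (mul_ne_zero hC0 ?_) ?_
    · exact fun h => hpq₁ (mob_eq_zero hq₁1 hp1 h)
    · exact fun h => hpq₂ (mob_eq_zero hq₂1 hp1 h)
  have dm := mob_hasDeriv hp1 hp1.le
  have dm0 : ((‖p‖ ^ 2 - 1 : ℝ) : ℂ) / (1 - (starRingEnd ℂ) p * p) ^ 2 ≠ 0 := by
    refine div_ne_zero ?_ (pow_ne_zero _ (mob_den hp1 hp1.le))
    have : ‖p‖ ^ 2 - 1 ≠ 0 := by nlinarith [norm_nonneg p]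
    exact_mod_cast this
  have dF₂ := dm.mul (hGS.hasDeriv hp1)
  rw [mob_self, zero_mul, add_zero] at dF₂
  -- F₁
  have dF₁ : HasDerivAt (fun z => u * mobius r (mobius p z ^ 2)) 0 p := by
    have e1 := dm.pow 2
    have e2 : HasDerivAt (fun z => mobius p z ^ 2) 0 p :=
      HasDerivAt.congr_deriv e1 (by simp [mob_self])
    have e3 := mob_hasDeriv (z := mobius p p ^ 2) hnr (by simp [mob_self])
    have e4 := (e3.comp p e2).const_mul u
    simpa using e4
  have msq : ∀ z ∈ unitDisc, ‖mobius p z ^ 2‖ < 1 := fun z hz => by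
    rw [norm_pow]
    have := mob_lt hp1 (mem_uD.1 hz)
    exact pow_lt_one₀ (norm_nonneg _) this two_ne_zero
  -- choice of t
  have ev : ∀ᶠ t in 𝓝[<] (1 : ℝ), t < 1 ∧ ‖p‖ < t ∧ ‖q₁‖ < t ∧ ‖q₂‖ < t ∧
      ‖p‖ / t * (‖q₁‖ / t) * (‖q₂‖ / t) * (‖p‖ / t) < M := by
    have hid : Tendsto (fun t : ℝ => t) (𝓝[<] 1) (𝓝 1) := nhdsWithin_le_nhds
    have T : ∀ x : ℝ, Tendsto (fun t : ℝ => x / t) (𝓝[<] 1) (𝓝 x) := fun x => by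
      have := (tendsto_const_nhds (x := x)).div hid one_ne_zero
      rw [div_one] at this
      exact this
    have TT := (((T ‖p‖).mul (T ‖q₁‖)).mul (T ‖q₂‖)).mul (T ‖p‖)
    have hlim : ‖p‖ * ‖q₁‖ * ‖q₂‖ * ‖p‖ < M := by
      have : ‖p‖ * ‖q₁‖ * ‖q₂‖ * ‖p‖ = r ^ 2 := by
        calc _ = ‖p‖ ^ 2 * (‖q₁‖ * ‖q₂‖) := by ring
          _ = r ^ 2 := by rw [hqn, hpn, hpr2]; ring
      rwa [this]
    filter_upwards [self_mem_nhdsWithin, hid.eventually_const_lt hp1,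
      hid.eventually_const_lt hq₁1, hid.eventually_const_lt hq₂1,
      TT.eventually_lt_const hlim] with t a1 a2 a3 a4 a5
    exact ⟨a1, a2, a3, a4, a5⟩
  obtain ⟨t, ht1, ht2, ht3, ht4, ht5⟩ := ev.exists
  refine upper_pert (p := p) (q₁ := q₁) (q₂ := q₂) (F₁ := fun z => u * mobius r (mobius p z ^ 2))
    (F₂ := fun z => mobius p z * G z) ht1 ht2 ht3 ht4 hp0 hq₂0 hpq₁ hpq₂ hne
    ?_ ?_ ?_ ?_ ?_ ?_ dF₁ ?_ ?_ ?_ ?_ dF₂ ?_ ?_ (mul_ne_zero dm0 Gp) ht5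
  · exact ((mob_diffOn hnr).comp ((mob_diffOn hp1).pow 2)
      (fun z hz => mem_uD.2 (msq z hz))).const_mul u
  · intro z hz
    rw [norm_mul, hun, one_mul]
    exact mob_lt hnr (msq z hz)
  · exact (mob_diffOn hp1).mul dG
  · intro z hz
    rw [norm_mul]
    have a1 := mob_lt hp1 (mem_uD.1 hz)
    have a2 := mG z hz
    nlinarith [norm_nonneg (mobius p z), norm_nonneg (G z)]
  · simp only [mob_zero]; rw [hp2, mob_self, mul_zero]
  · simp only [mob_self]; rw [zero_pow two_ne_zero, mob_zero, hur]
  · simp only [mq₁]; rw [keym, mul_neg, hur]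
  · simp only [mq₂]; rw [neg_sq, keym, mul_neg, hur]
  · simp only [hG, mob_zero]
    rw [hC]
    field_simp
  · simp only [mob_self, zero_mul]
  · simp only [hG, mob_self]; ring
  · simp only [hG, mob_self]; ring

/-- Theorem `limell4<ltilde`: with `b = -a` and `|a|² < |γ| ≤ |a|^{3/2}`,
`limsup_{ε→0, ε≠0} L^ε_{aVbV}(0,γ)` is strictly smaller than the corrected
generalized Lempert function
`𝐿̃_{aVbV} = min {L_{a0b0}, L_{aVb0}, L_{a0bV}, L_{aVbV}}` at `(0,γ)`. -/
theorem limsup_Leps4_lt_corrected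
    (a γ : ℂ) (ha : a ∈ unitDisc) (ha0 : a ≠ 0)
    (h1 : (‖a‖) ^ 2 < ‖γ‖)
    (h2 : ‖γ‖ ≤ (‖a‖) ^ ((3 : ℝ) / 2)) :
    Filter.limsup (fun ε => Leps4 a (-a) ε (0, γ)) (𝓝[≠] (0 : ℂ))
      < min (min (La0b0 a (-a) (0, γ)) (LaVb0 a (-a) (0, γ)))
            (min (La0bV a (-a) (0, γ)) (LaVbV a (-a) (0, γ))) := by
  obtain ⟨M, hM, hle⟩ := lower_all ha ha0 h1
  obtain ⟨M', hM1, hM2⟩ := exists_between hM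
  have hγ0 : γ ≠ 0 := by
    rintro rfl
    rw [norm_zero] at h1
    exact absurd h1 (not_lt.2 (sq_nonneg _))
  have hM0 : 0 < M' := (sq_nonneg ‖a‖).trans_lt hM1
  have hev := upper_all (mem_uD.1 ha) ha0 hγ0 h2 hM1
  exact (Filter.limsup_le_of_le (h := hev)).trans_lt ((elog_lt hM0 hM2).trans_le hle)
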